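/- Let Λ : 𝒟 → ℂ be a linear functional (no continuity assumed) on the Dirichlet space 𝒟 such that Λ(1) = 1 and Λ(g) ≠ 0 for every g ∈ 𝒟 that vanishes nowhere on the open unit disk 𝔻. Then there exists a point a ∈ 𝔻 such that Λ(f) = f(a) for all f ∈ 𝒟. -/

import Mathlib

open Complex MeasureTheory Metric Set

/-- Membership in the Dirichlet space `𝒟`: `f` is holomorphic on the open unit
disk and its Dirichlet integral `(1/π)∫_𝔻 |f′|² dA` is finite (equivalently,
`|f′|²` is integrable on the disk). -/
def MemDirichlet (f : ℂ → ℂ) : Prop :=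
  DifferentiableOn ℂ f (Metric.ball 0 1) ∧
    MeasureTheory.IntegrableOn (fun z => ‖deriv f z‖ ^ 2) (Metric.ball 0 1)

open scoped ComplexConjugate ENNReal

theorem integral_exp_mul_conj_exp (n m : ℕ) :
    ∫ θ in (-Real.pi)..Real.pi, exp (n * (θ * I)) * conj (exp (m * (θ * I))) =
      if n = m then 2 * (Real.pi : ℂ) else 0 := by
  have h : ∀ θ : ℝ, exp (n * (θ * I)) * conj (exp (m * (θ * I))) =
      exp (((n : ℂ) - m) * I * θ) := by
    intro θ
    rw [← exp_conj, ← exp_add]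
    congr 1
    simp
    ring
  simp_rw [h]
  split_ifs with hnm
  · subst hnm
    simp
    ring
  · have hc : ((n : ℂ) - m) * I ≠ 0 :=
      mul_ne_zero (sub_ne_zero.mpr (by exact_mod_cast hnm)) I_ne_zero
    rw [integral_exp_mul_complex hc]
    have : exp (((n : ℂ) - m) * I * (Real.pi : ℝ)) =
        exp (((n : ℂ) - m) * I * ((-Real.pi : ℝ) : ℂ)) := by
      rw [exp_eq_exp_iff_exists_int]
      exact ⟨(n : ℤ) - m, by push_cast; ring⟩
    rw [this, sub_self, zero_div]

theorem hasSum_integral_mul_of_summable {d : ℕ → ℂ} (hd : Summable fun n => ‖d n‖)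
    {h : ℝ → ℂ} (hh : Continuous h) :
    HasSum (fun n => d n * ∫ θ in (-Real.pi)..Real.pi, exp (n * (θ * I)) * h θ)
      (∫ θ in (-Real.pi)..Real.pi, (∑' n, d n * exp (n * (θ * I))) * h θ) := by
  have hnorm : ∀ (n : ℕ) (θ : ℝ), ‖exp (n * (θ * I))‖ = 1 := by
    intro n θ
    rw [show (n : ℂ) * (θ * I) = ((n * θ : ℝ) : ℂ) * I by push_cast; ring, norm_exp_ofReal_mul_I]
  have hs : ∀ θ : ℝ, Summable fun n => d n * exp (n * (θ * I)) := fun θ =>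
    Summable.of_norm (by simpa [hnorm] using hd)
  have := intervalIntegral.hasSum_integral_of_dominated_convergence (μ := volume)
    (a := -Real.pi) (b := Real.pi)
    (F := fun n θ => d n * (exp (n * (θ * I)) * h θ))
    (f := fun θ => (∑' n, d n * exp (n * (θ * I))) * h θ)
    (fun n θ => ‖d n‖ * ‖h θ‖)
    (fun n => (by fun_prop : Continuous _).aestronglyMeasurable)
    (fun n => .of_forall fun θ _ => by simp [hnorm])
    (.of_forall fun θ _ => hd.mul_right _)
    (by
      simp_rw [tsum_mul_right]
      exact (by fun_prop : Continuous _).intervalIntegrable _ _)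
    (.of_forall fun θ _ => by
      simpa [mul_assoc] using (hs θ).hasSum.mul_right (h θ))
  simpa only [intervalIntegral.integral_const_mul] using this

/-- Parseval's identity on the circle for an absolutely convergent power series. -/
theorem hasSum_integral_norm_sq {d : ℕ → ℂ} (hd : Summable fun n => ‖d n‖) :
    HasSum (fun n => 2 * Real.pi * ‖d n‖ ^ 2)
      (∫ θ in (-Real.pi)..Real.pi, ‖∑' n, d n * exp (n * (θ * I))‖ ^ 2) := by
  set G : ℝ → ℂ := fun θ => ∑' n, d n * exp (n * (θ * I)) with hG
  have hnorm : ∀ (n : ℕ) (θ : ℝ), ‖exp (n * (θ * I))‖ = 1 := by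
    intro n θ
    rw [show (n : ℂ) * (θ * I) = ((n * θ : ℝ) : ℂ) * I by push_cast; ring, norm_exp_ofReal_mul_I]
  have hGc : Continuous G :=
    continuous_tsum (fun n => by fun_prop) hd (fun n θ => by simp [hnorm])
  have hcoef : ∀ k : ℕ, ∫ θ in (-Real.pi)..Real.pi, exp (k * (θ * I)) * conj (G θ) =
      2 * Real.pi * conj (d k) := by
    intro k
    have h1 := hasSum_integral_mul_of_summable hd
      (h := fun θ => conj (exp (k * (θ * I)))) (by fun_prop)
    simp_rw [integral_exp_mul_conj_exp] at h1
    have h2 : ∫ θ in (-Real.pi)..Real.pi, G θ * conj (exp (k * (θ * I))) =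
        d k * (2 * Real.pi) := by
      rw [← h1.tsum_eq, tsum_eq_single k]
      · simp
      · intro n hn
        simp [hn]
    have h3 : (fun θ : ℝ => exp (k * (θ * I)) * conj (G θ)) =
        fun θ : ℝ => conj (G θ * conj (exp (k * (θ * I)))) := by
      funext θ
      simp [mul_comm]
    have hle : -Real.pi ≤ Real.pi := by linarith [Real.pi_pos]
    rw [h3, intervalIntegral.integral_of_le hle, integral_conj,
      ← intervalIntegral.integral_of_le hle, h2, map_mul, map_mul, conj_ofReal, map_ofNat]
    ring
  have h1 := hasSum_integral_mul_of_summable hd (h := fun θ => conj (G θ)) (by fun_prop)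
  simp_rw [hcoef] at h1
  rw [← hasSum_ofReal, ← intervalIntegral.integral_ofReal]
  convert! h1 using 2 with n
  · push_cast
    rw [← mul_conj']
    ring
  · funext θ
    push_cast
    rw [← mul_conj']

theorem lintegral_circle_enorm_sq {g : ℂ → ℂ} {c : ℕ → ℂ}
    (hg : ∀ z ∈ ball (0 : ℂ) 1, HasSum (fun n => c n * z ^ n) (g z)) {r : ℝ}
    (hr0 : 0 ≤ r) (hr1 : r < 1) :
    ∫⁻ θ in Ioo (-Real.pi) Real.pi, ‖g (r * (Real.cos θ + Real.sin θ * I))‖ₑ ^ 2 =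
      ∑' n, ENNReal.ofReal (2 * Real.pi * (‖c n‖ ^ 2 * r ^ (2 * n))) := by
  have hd : Summable fun n => ‖c n * (r : ℂ) ^ n‖ :=
    (hg r (by simpa [abs_of_nonneg hr0] using hr1)).summable.norm
  have hP := hasSum_integral_norm_sq hd
  have hG : ∀ θ : ℝ, g (r * (Real.cos θ + Real.sin θ * I)) =
      ∑' n, c n * (r : ℂ) ^ n * exp (n * (θ * I)) := by
    intro θ
    rw [show (Real.cos θ + Real.sin θ * I : ℂ) = exp (θ * I) by
      rw [exp_mul_I, ofReal_cos, ofReal_sin]]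
    have hz : (r : ℂ) * exp (θ * I) ∈ ball (0 : ℂ) 1 := by
      simpa [norm_exp_ofReal_mul_I, abs_of_nonneg hr0] using hr1
    rw [← (hg _ hz).tsum_eq]
    congr 1
    funext n
    rw [mul_pow, ← exp_nat_mul]
    ring
  have hnorm : ∀ (n : ℕ) (θ : ℝ), ‖exp (n * (θ * I))‖ = 1 := by
    intro n θ
    rw [show (n : ℂ) * (θ * I) = ((n * θ : ℝ) : ℂ) * I by push_cast; ring, norm_exp_ofReal_mul_I]
  have hGc : Continuous fun θ : ℝ => ∑' n, c n * (r : ℂ) ^ n * exp (n * (θ * I)) :=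
    continuous_tsum (fun n => by fun_prop) hd (fun n θ => by simp [hnorm])
  rw [← ENNReal.ofReal_tsum_of_nonneg (fun n => by positivity)]
  · have : ∀ n, 2 * Real.pi * (‖c n‖ ^ 2 * r ^ (2 * n)) =
        2 * Real.pi * ‖c n * (r : ℂ) ^ n‖ ^ 2 := by
      intro n
      rw [norm_mul, norm_pow, norm_real, Real.norm_of_nonneg hr0]
      ring
    simp_rw [this, hP.tsum_eq]
    rw [intervalIntegral.integral_of_le (by linarith [Real.pi_pos]),
      integral_Ioc_eq_integral_Ioo, ofReal_integral_eq_lintegral_ofReal]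
    · congr 1
      funext θ
      rw [hG, ← ofReal_norm, ENNReal.ofReal_pow (norm_nonneg _)]
    · exact ((by fun_prop : Continuous fun θ : ℝ => 
        ‖∑' n, c n * (r : ℂ) ^ n * exp (n * (θ * I))‖ ^ 2).integrableOn_Icc).mono_set
        Ioo_subset_Icc_self
    · exact .of_forall fun θ => by positivity
  · refine (hP.summable).congr fun n => ?_
    rw [norm_mul, norm_pow, norm_real, Real.norm_of_nonneg hr0]
    ring

theorem lintegral_mul_pow_Ioo (n : ℕ) {a : ℝ} (ha : 0 ≤ a) :
    ∫⁻ r in Ioo (0 : ℝ) 1, ENNReal.ofReal r * ENNReal.ofReal (2 * Real.pi * (a * r ^ (2 * n))) =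
      ENNReal.ofReal (Real.pi * (a / (n + 1))) := by
  have h1 : ∫⁻ r in Ioo (0 : ℝ) 1,
      ENNReal.ofReal r * ENNReal.ofReal (2 * Real.pi * (a * r ^ (2 * n))) =
      ∫⁻ r in Ioo (0 : ℝ) 1, ENNReal.ofReal (2 * Real.pi * a * r ^ (2 * n + 1)) := by
    refine setLIntegral_congr_fun measurableSet_Ioo fun r hr => ?_
    rw [← ENNReal.ofReal_mul hr.1.le]
    congr 1
    ring
  rw [h1, ← ofReal_integral_eq_lintegral_ofReal]
  · rw [← integral_Ioc_eq_integral_Ioo, ← intervalIntegral.integral_of_le zero_le_one,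
      intervalIntegral.integral_const_mul, integral_pow]
    congr 1
    have : (n : ℝ) + 1 ≠ 0 := by positivity
    simp
    field_simp
    ring
  · exact ((by fun_prop : Continuous fun r : ℝ => 
        2 * Real.pi * a * r ^ (2 * n + 1)).integrableOn_Icc).mono_set Ioo_subset_Icc_self
  · refine (ae_restrict_iff' measurableSet_Ioo).mpr (.of_forall fun r hr => ?_)
    have := hr.1
    have := Real.pi_pos
    simp only [Pi.zero_apply]
    positivity

/-- The area integral over the unit disk of the squared modulus of a power series. -/
theorem lintegral_ball_enorm_sq {g : ℂ → ℂ} {c : ℕ → ℂ} (hgm : Measurable g)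
    (hg : ∀ z ∈ ball (0 : ℂ) 1, HasSum (fun n => c n * z ^ n) (g z)) :
    ∫⁻ z in ball (0 : ℂ) 1, ‖g z‖ₑ ^ 2 =
      ∑' n : ℕ, ENNReal.ofReal (Real.pi * (‖c n‖ ^ 2 / (n + 1))) := by
  have hF : Measurable ((ball (0 : ℂ) 1).indicator fun z => ‖g z‖ₑ ^ 2) :=
    (hgm.enorm.pow_const 2).indicator measurableSet_ball
  rw [← lintegral_indicator measurableSet_ball, ← Complex.lintegral_comp_polarCoord_symm,
    polarCoord_target, Measure.volume_eq_prod,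
    setLIntegral_prod _ (by
      simp only [Complex.polarCoord_symm_apply]
      exact (Measurable.aemeasurable (by fun_prop)))]
  have h1 : ∀ r ∈ Ioi (0 : ℝ), ∫⁻ θ in Ioo (-Real.pi) Real.pi, ENNReal.ofReal r •
      (ball (0 : ℂ) 1).indicator (fun z => ‖g z‖ₑ ^ 2) (Complex.polarCoord.symm (r, θ)) =
      (Ioo (0 : ℝ) 1).indicator (fun r => ∑' n, ENNReal.ofReal r *
        ENNReal.ofReal (2 * Real.pi * (‖c n‖ ^ 2 * r ^ (2 * n)))) r := by
    intro r hr
    have hr' : (0 : ℝ) < r := hr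
    have hmem : ∀ θ : ℝ, Complex.polarCoord.symm (r, θ) ∈ ball (0 : ℂ) 1 ↔ r < 1 := by
      intro θ
      rw [mem_ball_zero_iff, Complex.norm_polarCoord_symm, abs_of_pos hr']
    by_cases hr1 : r < 1
    · rw [indicator_of_mem (show r ∈ Ioo (0 : ℝ) 1 from ⟨hr, hr1⟩), ENNReal.tsum_mul_left,
        ← lintegral_circle_enorm_sq hg hr'.le hr1, ← lintegral_const_mul' _ _ ENNReal.ofReal_ne_top]
      congr 1
      funext θ
      rw [indicator_of_mem ((hmem θ).mpr hr1), Complex.polarCoord_symm_apply, smul_eq_mul]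
    · rw [indicator_of_notMem (fun h => hr1 h.2)]
      have h0 : ∀ θ : ℝ, (ball (0 : ℂ) 1).indicator (fun z => ‖g z‖ₑ ^ 2)
          (Complex.polarCoord.symm (r, θ)) = 0 := fun θ =>
        indicator_of_notMem (fun h => hr1 ((hmem θ).mp h)) _
      simp only [h0, smul_zero, lintegral_zero]
  rw [setLIntegral_congr_fun measurableSet_Ioi h1, lintegral_indicator measurableSet_Ioo,
    Measure.restrict_restrict measurableSet_Ioo,
    inter_eq_self_of_subset_left Ioo_subset_Ioi_self,
    lintegral_tsum (fun n => Measurable.aemeasurable (by fun_prop))]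
  congr 1
  funext n
  exact lintegral_mul_pow_Ioo n (by positivity)

theorem differentiableOn_and_hasSum_deriv {f : ℂ → ℂ} {a : ℕ → ℂ}
    (hf : ∀ z ∈ ball (0 : ℂ) 1, HasSum (fun n => a n * z ^ n) (f z)) :
    DifferentiableOn ℂ f (ball 0 1) ∧
      ∀ z ∈ ball (0 : ℂ) 1, HasSum (fun n : ℕ => ((n : ℂ) + 1) * a (n + 1) * z ^ n)
        (deriv f z) := by
  have key : ∀ z ∈ ball (0 : ℂ) 1, DifferentiableAt ℂ f z ∧
      HasSum (fun n : ℕ => ((n : ℂ) + 1) * a (n + 1) * z ^ n) (deriv f z) := by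
    intro z hz
    obtain ⟨ρ, hzρ, hρ1⟩ := exists_between (mem_ball_zero_iff.mp hz)
    have hρ0 : 0 ≤ ρ := (norm_nonneg z).trans hzρ.le
    have hu : Summable fun n => ‖a n * (ρ : ℂ) ^ n‖ :=
      (hf ρ (by simpa [abs_of_nonneg hρ0] using hρ1)).summable.norm
    have hle : ∀ (n : ℕ) (w : ℂ), w ∈ ball (0 : ℂ) ρ →
        ‖a n * w ^ n‖ ≤ ‖a n * (ρ : ℂ) ^ n‖ := by
      intro n w hw
      rw [norm_mul, norm_mul, norm_pow, norm_pow, norm_real, Real.norm_of_nonneg hρ0]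
      gcongr
      exact (mem_ball_zero_iff.mp hw).le
    have hd : ∀ n : ℕ, DifferentiableOn ℂ (fun w : ℂ => a n * w ^ n) (ball 0 ρ) :=
      fun n => by fun_prop
    have hzρ' : z ∈ ball (0 : ℂ) ρ := mem_ball_zero_iff.mpr hzρ
    have heq : f =ᶠ[nhds z] fun w => ∑' n, a n * w ^ n :=
      Filter.eventually_of_mem (isOpen_ball.mem_nhds hz) fun w hw => (hf w hw).tsum_eq.symm
    constructor
    · exact ((differentiableOn_tsum_of_summable_norm hu hd isOpen_ball hle).differentiableAt
        (isOpen_ball.mem_nhds hzρ')).congr_of_eventuallyEq heq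
    · have h := hasSum_deriv_of_summable_norm hu hd isOpen_ball hle hzρ'
      rw [← heq.deriv_eq, ← hasSum_nat_add_iff' 1] at h
      simpa [mul_comm, mul_assoc, mul_left_comm] using h
  exact ⟨fun z hz => (key z hz).1.differentiableWithinAt, fun z hz => (key z hz).2⟩

theorem exists_hasSum_of_differentiableOn {f : ℂ → ℂ} (hf : DifferentiableOn ℂ f (ball 0 1)) :
    ∃ a : ℕ → ℂ, ∀ z ∈ ball (0 : ℂ) 1, HasSum (fun n => a n * z ^ n) (f z) := by
  refine ⟨fun n => (n.factorial : ℂ)⁻¹ * iteratedDeriv n f 0, fun z hz => ?_⟩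
  have := Complex.hasSum_taylorSeries_on_ball hf hz
  simpa [mul_comm, mul_assoc, mul_left_comm] using this

/-- A measurable power series on the disk is square integrable as soon as the weighted sum of the
squares of its coefficients converges. -/
theorem integrableOn_norm_sq_iff {g : ℂ → ℂ} {c : ℕ → ℂ} (hgm : Measurable g)
    (hg : ∀ z ∈ ball (0 : ℂ) 1, HasSum (fun n => c n * z ^ n) (g z)) :
    IntegrableOn (fun z => ‖g z‖ ^ 2) (ball 0 1) ↔
      Summable fun n : ℕ => ‖c n‖ ^ 2 / ((n : ℝ) + 1) := by
  have hm : AEStronglyMeasurable (fun z => ‖g z‖ ^ 2) (volume.restrict (ball (0 : ℂ) 1)) :=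
    (hgm.norm.pow_const 2).aestronglyMeasurable
  have h0 : ∀ n : ℕ, 0 ≤ Real.pi * (‖c n‖ ^ 2 / ((n : ℝ) + 1)) := fun n => by positivity
  rw [IntegrableOn, Integrable, and_iff_right hm, hasFiniteIntegral_iff_enorm]
  simp only [enorm_pow, enorm_norm]
  rw [lintegral_ball_enorm_sq hgm hg, lt_top_iff_ne_top]
  constructor
  · intro h
    have := ENNReal.summable_toReal h
    simp only [ENNReal.toReal_ofReal (h0 _)] at this
    exact (summable_mul_left_iff Real.pi_ne_zero).mp this
  · intro h
    exact (h.mul_left Real.pi).tsum_ofReal_ne_top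

theorem memDirichlet_iff_summable {f : ℂ → ℂ} {a : ℕ → ℂ}
    (hf : ∀ z ∈ ball (0 : ℂ) 1, HasSum (fun n => a n * z ^ n) (f z)) :
    MemDirichlet f ↔ Summable fun n : ℕ => (n : ℝ) * ‖a n‖ ^ 2 := by
  obtain ⟨hd, hs⟩ := differentiableOn_and_hasSum_deriv hf
  rw [MemDirichlet, and_iff_right hd, integrableOn_norm_sq_iff (measurable_deriv f) hs,
    ← summable_nat_add_iff 1 (f := fun n : ℕ => (n : ℝ) * ‖a n‖ ^ 2)]
  refine summable_congr fun n => ?_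
  have h1 : ‖(n : ℂ) + 1‖ = (n : ℝ) + 1 := by exact_mod_cast Complex.norm_natCast (n + 1)
  have h2 : (n : ℝ) + 1 ≠ 0 := by positivity
  rw [norm_mul, h1]
  push_cast
  field_simp

theorem MemDirichlet.exists_coeff {f : ℂ → ℂ} (hf : MemDirichlet f) :
    ∃ a : ℕ → ℂ, (∀ z ∈ ball (0 : ℂ) 1, HasSum (fun n => a n * z ^ n) (f z)) ∧
      Summable fun n : ℕ => (n : ℝ) * ‖a n‖ ^ 2 := by
  obtain ⟨a, ha⟩ := exists_hasSum_of_differentiableOn hf.1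
  exact ⟨a, ha, (memDirichlet_iff_summable ha).mp hf⟩

theorem memDirichlet_const (c : ℂ) : MemDirichlet fun _ => c :=
  ⟨differentiableOn_const c, by simp⟩

theorem MemDirichlet.add {f g : ℂ → ℂ} (hf : MemDirichlet f) (hg : MemDirichlet g) :
    MemDirichlet (f + g) := by
  obtain ⟨a, ha, has⟩ := hf.exists_coeff
  obtain ⟨b, hb, hbs⟩ := hg.exists_coeff
  have hab : ∀ z ∈ ball (0 : ℂ) 1, HasSum (fun n => (a n + b n) * z ^ n) ((f + g) z) :=
    fun z hz => by simpa [add_mul] using (ha z hz).add (hb z hz)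
  rw [memDirichlet_iff_summable hab]
  refine Summable.of_nonneg_of_le (fun n => by positivity) (fun n => ?_)
    ((has.add hbs).mul_left 2)
  have h1 := norm_add_le (a n) (b n)
  have h2 : ‖a n + b n‖ ^ 2 ≤ 2 * (‖a n‖ ^ 2 + ‖b n‖ ^ 2) := by
    nlinarith [norm_nonneg (a n + b n), sq_nonneg (‖a n‖ - ‖b n‖)]
  have h3 : (0 : ℝ) ≤ n := n.cast_nonneg
  nlinarith

theorem MemDirichlet.smul {f : ℂ → ℂ} (c : ℂ) (hf : MemDirichlet f) : MemDirichlet (c • f) := by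
  obtain ⟨a, ha, has⟩ := hf.exists_coeff
  have hca : ∀ z ∈ ball (0 : ℂ) 1, HasSum (fun n => (c * a n) * z ^ n) ((c • f) z) :=
    fun z hz => by simpa [mul_assoc] using (ha z hz).mul_left c
  rw [memDirichlet_iff_summable hca]
  refine (has.mul_left (‖c‖ ^ 2)).congr fun n => ?_
  rw [norm_mul]
  ring

theorem MemDirichlet.id_mul {f : ℂ → ℂ} (hf : MemDirichlet f) :
    MemDirichlet fun z => z * f z := by
  obtain ⟨a, ha, has⟩ := hf.exists_coeff
  let b : ℕ → ℂ := fun n => Nat.casesOn n 0 a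
  have hb : ∀ z ∈ ball (0 : ℂ) 1, HasSum (fun n => b n * z ^ n) (z * f z) := by
    intro z hz
    rw [← hasSum_nat_add_iff' 1]
    simpa [b, pow_succ, mul_comm, mul_assoc, mul_left_comm] using (ha z hz).mul_left z
  rw [memDirichlet_iff_summable hb, ← summable_nat_add_iff 2]
  refine Summable.of_nonneg_of_le (fun n => by positivity) (fun n => ?_)
    (((summable_nat_add_iff 1).mpr has).mul_left 2)
  have h3 : (0 : ℝ) ≤ n := n.cast_nonneg
  simp only [b]
  push_cast
  nlinarith [sq_nonneg ‖a (n + 1)‖, mul_nonneg h3 (sq_nonneg ‖a (n + 1)‖)]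

theorem MemDirichlet.integrableOn_norm_sq {f : ℂ → ℂ} (hf : MemDirichlet f) :
    IntegrableOn (fun z => ‖f z‖ ^ 2) (ball 0 1) := by
  classical
  obtain ⟨a, ha, has⟩ := hf.exists_coeff
  let g : ℂ → ℂ := (ball (0 : ℂ) 1).piecewise f fun _ => 0
  have hgm : Measurable g :=
    hf.1.continuousOn.measurable_piecewise continuousOn_const measurableSet_ball
  have hgf : ∀ z ∈ ball (0 : ℂ) 1, g z = f z := fun z hz => piecewise_eq_of_mem _ _ _ hz
  have hg : IntegrableOn (fun z => ‖g z‖ ^ 2) (ball 0 1) := by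
    rw [integrableOn_norm_sq_iff hgm (fun z hz => by rw [hgf z hz]; exact ha z hz),
      ← summable_nat_add_iff 1]
    refine Summable.of_nonneg_of_le (fun n => by positivity) (fun n => ?_)
      ((summable_nat_add_iff 1).mpr has)
    have h3 : (0 : ℝ) ≤ n := n.cast_nonneg
    rw [div_le_iff₀ (by positivity)]
    push_cast
    have h4 : 1 ≤ ((n : ℝ) + 1) * (n + 1 + 1) := by nlinarith
    nlinarith [sq_nonneg ‖a (n + 1)‖]
  exact hg.congr_fun (fun z hz => by simp only [hgf z hz]) measurableSet_ball

theorem MemDirichlet.dslope {f : ℂ → ℂ} (hf : MemDirichlet f) {a : ℂ}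
    (ha : a ∈ ball (0 : ℂ) 1) : MemDirichlet (dslope f a) := by
  have hq : DifferentiableOn ℂ (_root_.dslope f a) (ball 0 1) :=
    (differentiableOn_dslope (isOpen_ball.mem_nhds ha)).mpr hf.1
  refine ⟨hq, ?_⟩
  obtain ⟨ρ, haρ, hρ1⟩ := exists_between (mem_ball_zero_iff.mp ha)
  have hsub : closedBall (0 : ℂ) ρ ⊆ ball 0 1 := closedBall_subset_ball hρ1
  have hsplit : ball (0 : ℂ) 1 = closedBall 0 ρ ∪ (ball 0 1 \ closedBall 0 ρ) :=
    (union_sdiff_cancel hsub).symm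
  have hin : IntegrableOn (fun z => ‖deriv (_root_.dslope f a) z‖ ^ 2) (closedBall 0 ρ) :=
    (((hq.deriv isOpen_ball).continuousOn.mono hsub).norm.pow 2).integrableOn_compact
      (isCompact_closedBall 0 ρ)
  have hfa : IntegrableOn (fun z => ‖f z - f a‖ ^ 2) (ball 0 1) := by
    have := (hf.add (memDirichlet_const (-f a))).integrableOn_norm_sq
    simpa [sub_eq_add_neg] using this
  set δ := ρ - ‖a‖ with hδ
  have hδ0 : 0 < δ := sub_pos.mpr haρ
  have hout : IntegrableOn (fun z => ‖deriv (_root_.dslope f a) z‖ ^ 2)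
      (ball 0 1 \ closedBall 0 ρ) := by
    have hdom : IntegrableOn
        (fun z => 2 / δ ^ 2 * ‖deriv f z‖ ^ 2 + 2 / δ ^ 4 * ‖f z - f a‖ ^ 2)
        (ball 0 1 \ closedBall 0 ρ) :=
      IntegrableOn.mono_set (Integrable.add (hf.2.const_mul _) (hfa.const_mul _)) sdiff_subset
    refine Integrable.mono' hdom
      (((measurable_deriv _).norm.pow_const 2).aestronglyMeasurable) ?_
    refine (ae_restrict_iff' (measurableSet_ball.diff measurableSet_closedBall)).mpr
      (.of_forall fun z hz => ?_)
    have hzρ : ρ < ‖z‖ := by simpa using hz.2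
    have hza : δ ≤ ‖z - a‖ := by
      have := norm_sub_norm_le z a
      linarith
    have hne : z - a ≠ 0 := norm_pos_iff.mp (hδ0.trans_le hza)
    have hne' : z ≠ a := sub_ne_zero.mp hne
    have hfd : DifferentiableAt ℂ f z := hf.1.differentiableAt (isOpen_ball.mem_nhds hz.1)
    have heq : _root_.dslope f a =ᶠ[nhds z] fun w => (f w - f a) / (w - a) := by
      filter_upwards [isOpen_ne.mem_nhds hne'] with w hw
      rw [dslope_of_ne _ hw, slope_def_field]
    have hderiv : deriv (_root_.dslope f a) z =
        deriv f z / (z - a) - (f z - f a) / (z - a) ^ 2 := by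
      rw [heq.deriv_eq]
      have h := (hfd.hasDerivAt.sub_const (f a)).div
        ((hasDerivAt_id z).sub_const a) hne
      have h' := h.deriv
      simp only [id] at h'
      refine h'.trans ?_
      field_simp
    have h1 : ‖deriv f z / (z - a)‖ ≤ ‖deriv f z‖ / δ := by
      rw [norm_div]
      gcongr
    have h2 : ‖(f z - f a) / (z - a) ^ 2‖ ≤ ‖f z - f a‖ / δ ^ 2 := by
      rw [norm_div, norm_pow]
      gcongr
    rw [hderiv, Real.norm_of_nonneg (by positivity)]
    have h3 := (norm_sub_le (deriv f z / (z - a)) ((f z - f a) / (z - a) ^ 2)).trans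
      (add_le_add h1 h2)
    calc _ ≤ (‖deriv f z‖ / δ + ‖f z - f a‖ / δ ^ 2) ^ 2 := by gcongr
      _ ≤ 2 * (‖deriv f z‖ / δ) ^ 2 + 2 * (‖f z - f a‖ / δ ^ 2) ^ 2 := by
        nlinarith [sq_nonneg (‖deriv f z‖ / δ - ‖f z - f a‖ / δ ^ 2)]
      _ = _ := by
        field_simp
  rw [hsplit]
  exact hin.union hout

theorem Multiset.sq_sum_eq_add_two_mul_esymm {R : Type*} [CommRing R] (s : Multiset R) :
    s.sum ^ 2 = (s.map (· ^ 2)).sum + 2 * s.esymm 2 := by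
  induction s using Multiset.induction with
  | empty => simp [Multiset.esymm, Multiset.powersetCard_zero_right]
  | cons a s ih =>
    have h : (a ::ₘ s).esymm 2 = s.esymm 2 + a * s.sum := by
      have := Multiset.sum_map_mul_left (s := s) (a := a) (f := fun x => x)
      simpa [Multiset.esymm, Multiset.powersetCard_cons, Multiset.powersetCard_one,
        Multiset.map_map, Function.comp_def] using this
    rw [h, Multiset.sum_cons, Multiset.map_cons, Multiset.sum_cons]
    linear_combination ih

/-- If the binomial transforms of a sequence with `c 0 = 1` have all their roots in the open unit
disk, then `c 2 = c 1 ^ 2`. -/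
theorem sq_eq_of_binomial_sum_ne_zero {c : ℕ → ℂ} (h0 : c 0 = 1)
    (h : ∀ (n : ℕ) (w : ℂ), 1 ≤ ‖w‖ →
      ∑ m ∈ Finset.range (n + 1), w ^ m * ((-1) ^ (n - m) * c (n - m) * n.choose m) ≠ 0) :
    c 2 = c 1 ^ 2 := by
  have key : ∀ n : ℕ, 2 ≤ n → n * ‖c 1 ^ 2 - c 2‖ ≤ 1 + ‖c 2‖ := by
    intro n hn
    set b : ℕ → ℂ := fun m => (-1) ^ (n - m) * c (n - m) * n.choose m with hb
    let P : Polynomial ℂ := ∑ m ∈ Finset.range (n + 1), Polynomial.C (b m) * Polynomial.X ^ m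
    have hcoeff : ∀ m, m ≤ n → P.coeff m = b m := by
      intro m hm
      simp only [P, Polynomial.finsetSum_coeff, Polynomial.coeff_C_mul_X_pow]
      rw [Finset.sum_ite_eq, if_pos (Finset.mem_range.mpr (by lia))]
    have hbn : b n = 1 := by simp [hb, h0]
    have hdeg : P.natDegree = n := by
      refine le_antisymm ?_ (Polynomial.le_natDegree_of_ne_zero ?_)
      · refine Polynomial.natDegree_sum_le_of_forall_le _ _ fun m hm => ?_
        exact (Polynomial.natDegree_C_mul_X_pow_le _ _).trans
          (Nat.lt_succ_iff.mp (Finset.mem_range.mp hm))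
      · rw [hcoeff n le_rfl, hbn]
        exact one_ne_zero
    have hmonic : P.leadingCoeff = 1 := by
      rw [Polynomial.leadingCoeff, hdeg, hcoeff n le_rfl, hbn]
    have hP0 : P ≠ 0 := fun h => by simp [h] at hmonic
    have hcard : P.roots.card = P.natDegree :=
      Polynomial.splits_iff_card_roots.mp (IsAlgClosed.splits P)
    have hroot : ∀ w ∈ P.roots, ‖w‖ < 1 := by
      intro w hw
      by_contra! hw1
      refine h n w hw1 ?_
      have := (Polynomial.mem_roots hP0).mp hw
      rw [Polynomial.IsRoot, Polynomial.eval_finsetSum] at this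
      simpa [hb, mul_comm] using this
    have h1 : P.roots.sum = n * c 1 := by
      have := Polynomial.coeff_eq_esymm_roots_of_card hcard (k := n - 1) (by lia)
      rw [hcoeff _ (by lia), hmonic, hdeg, show n - (n - 1) = 1 by lia] at this
      simp only [hb, show n - (n - 1) = 1 by lia, Nat.choose_symm (show 1 ≤ n by lia),
        Nat.choose_one_right, Multiset.esymm, Multiset.powersetCard_one, Multiset.map_map,
        Function.comp_def, Multiset.prod_singleton, Multiset.map_id'] at this
      linear_combination this
    have h2 : 2 * P.roots.esymm 2 = n * (n - 1) * c 2 := by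
      have := Polynomial.coeff_eq_esymm_roots_of_card hcard (k := n - 2) (by lia)
      rw [hcoeff _ (by lia), hmonic, hdeg, show n - (n - 2) = 2 by lia] at this
      simp only [hb, show n - (n - 2) = 2 by lia, Nat.choose_symm hn] at this
      have hch : (n.choose 2 : ℂ) = n * (n - 1) / 2 := Nat.cast_choose_two ℂ n
      rw [hch] at this
      linear_combination -2 * this
    have h3 : ‖(P.roots.map (· ^ 2)).sum‖ ≤ n := by
      refine (norm_multiset_sum_le _).trans ?_
      rw [Multiset.map_map]
      have := Multiset.sum_le_card_nsmul (P.roots.map ((fun x => ‖x‖) ∘ (· ^ 2))) (1 : ℝ) (by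
        intro x hx
        obtain ⟨w, hw, rfl⟩ := Multiset.mem_map.mp hx
        simp only [Function.comp_apply, norm_pow]
        exact pow_le_one₀ (norm_nonneg w) (hroot w hw).le)
      simpa [hcard, hdeg] using this
    have h4 : (P.roots.map (· ^ 2)).sum = n * (n * (c 1 ^ 2 - c 2)) + n * c 2 := by
      have := Multiset.sq_sum_eq_add_two_mul_esymm P.roots
      rw [h1, h2] at this
      linear_combination -this
    have hnpos : (0 : ℝ) < n := by positivity
    have h5 : n * (n * ‖c 1 ^ 2 - c 2‖) ≤ n * (1 + ‖c 2‖) := by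
      have h6 : (n : ℂ) * (n * (c 1 ^ 2 - c 2)) =
          (P.roots.map (· ^ 2)).sum - n * c 2 := by rw [h4]; ring
      have h7 := congrArg norm h6
      rw [norm_mul, norm_mul, Complex.norm_natCast] at h7
      rw [h7]
      refine (norm_sub_le _ _).trans ?_
      rw [norm_mul, Complex.norm_natCast]
      linarith
    exact le_of_mul_le_mul_left h5 hnpos
  by_contra hne
  have hpos : 0 < ‖c 1 ^ 2 - c 2‖ := norm_pos_iff.mpr (sub_ne_zero.mpr (Ne.symm hne))
  obtain ⟨N, hN⟩ := exists_nat_gt ((1 + ‖c 2‖) / ‖c 1 ^ 2 - c 2‖)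
  rw [div_lt_iff₀ hpos] at hN
  have := key (N + 2) (by lia)
  push_cast at this
  nlinarith

/-- The Dirichlet space as a space of functions on `ℂ`. -/
def dirichletSpace : Submodule ℂ (ℂ → ℂ) where
  carrier := {f | MemDirichlet f}
  add_mem' := MemDirichlet.add
  zero_mem' := memDirichlet_const 0
  smul_mem' c _ hf := MemDirichlet.smul c hf

/-- The shift operator, multiplication by the coordinate function. -/
def dirichletShift : Module.End ℂ dirichletSpace where
  toFun f := ⟨fun z => z * f.1 z, MemDirichlet.id_mul f.2⟩
  map_add' f g := by ext z; simp [mul_add]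
  map_smul' c f := by ext z; simp [mul_left_comm]

theorem sub_dirichletShift_pow_apply (w : ℂ) (n : ℕ) (g : dirichletSpace) (z : ℂ) :
    (((w • (1 : Module.End ℂ dirichletSpace) - dirichletShift) ^ n) g).1 z = (w - z) ^ n * g.1 z := by
  induction n with
  | zero => simp
  | succ n ih =>
    rw [pow_succ', Module.End.mul_apply]
    change w * (((w • (1 : Module.End ℂ dirichletSpace) - dirichletShift) ^ n) g).1 z -
      z * (((w • (1 : Module.End ℂ dirichletSpace) - dirichletShift) ^ n) g).1 z = _
    rw [ih]
    ring

theorem map_shift_shift_mul_eq_sq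
    {L : dirichletSpace →ₗ[ℂ] ℂ}
    (hL : ∀ g : dirichletSpace, (∀ z ∈ ball (0 : ℂ) 1, g.1 z ≠ 0) → L g ≠ 0)
    {g : dirichletSpace} (hg : ∀ z ∈ ball (0 : ℂ) 1, g.1 z ≠ 0) :
    L (dirichletShift (dirichletShift g)) * L g = L (dirichletShift g) ^ 2 := by
  have hLg := hL g hg
  have := sq_eq_of_binomial_sum_ne_zero (c := fun k => L ((dirichletShift ^ k) g) / L g)
    (by simp [hLg]) (by
      intro n w hw hsum
      have hne : L (((w • (1 : Module.End ℂ dirichletSpace) - dirichletShift) ^ n) g) ≠ 0 := by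
        refine hL _ fun z hz => ?_
        rw [sub_dirichletShift_pow_apply]
        refine mul_ne_zero (pow_ne_zero _ (sub_ne_zero.mpr ?_)) (hg z hz)
        rintro rfl
        exact absurd (mem_ball_zero_iff.mp hz) (not_lt.mpr hw)
      apply hne
      have hcomm : Commute (w • 1 : Module.End ℂ dirichletSpace) (-dirichletShift) :=
        ((Commute.one_left _).smul_left w)
      have hpow : (w • (1 : Module.End ℂ dirichletSpace) - dirichletShift) ^ n =
          ∑ m ∈ Finset.range (n + 1), (w • (1 : Module.End ℂ dirichletSpace)) ^ m *
            (-dirichletShift) ^ (n - m) * (n.choose m : Module.End ℂ dirichletSpace) := by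
        have hsub : w • (1 : Module.End ℂ dirichletSpace) - dirichletShift =
            w • (1 : Module.End ℂ dirichletSpace) + -dirichletShift :=
          LinearMap.ext fun f => sub_eq_add_neg (w • f) (dirichletShift f)
        rw [hsub]
        exact hcomm.add_pow n
      rw [hpow, LinearMap.sum_apply, map_sum]
      have hterm : ∀ m ∈ Finset.range (n + 1),
          L (((w • (1 : Module.End ℂ dirichletSpace)) ^ m * (-dirichletShift) ^ (n - m) *
            (n.choose m : Module.End ℂ dirichletSpace)) g) =
          L g * (w ^ m * ((-1) ^ (n - m) * (L ((dirichletShift ^ (n - m)) g) / L g) *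
            n.choose m)) := by
        intro m _
        have h1 : (-dirichletShift) ^ (n - m) = ((-1 : ℂ) ^ (n - m)) • dirichletShift ^ (n - m) := by
          have hneg : -dirichletShift = (-1 : ℂ) • dirichletShift :=
            LinearMap.ext fun f => (neg_one_smul ℂ (dirichletShift f)).symm
          rw [← smul_pow, hneg]
        have h2 : (n.choose m : Module.End ℂ dirichletSpace) = (n.choose m : ℂ) • 1 := by
          rw [Nat.cast_smul_eq_nsmul, nsmul_one]
        rw [smul_pow, one_pow, h1, h2]
        simp only [smul_mul_assoc, mul_smul_comm, one_mul, mul_one, LinearMap.smul_apply,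
          map_smul, smul_eq_mul]
        field_simp
      rw [Finset.sum_congr rfl hterm, ← Finset.mul_sum, hsum, mul_zero])
  simp only [pow_one, pow_two, Module.End.mul_apply] at this
  field_simp at this
  rw [pow_two]
  linear_combination this

/-- The point at which `L` evaluates multipliers is the same for `g` and for the constants. -/
theorem map_shift_eq_of_ne_zero
    {L : dirichletSpace →ₗ[ℂ] ℂ}
    (hL : ∀ g : dirichletSpace, (∀ z ∈ ball (0 : ℂ) 1, g.1 z ≠ 0) → L g ≠ 0)
    {g u : dirichletSpace} (hg : ∀ z ∈ ball (0 : ℂ) 1, g.1 z ≠ 0)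
    (hu : ∀ z ∈ ball (0 : ℂ) 1, u.1 z ≠ 0) (hgu : ∀ z ∈ ball (0 : ℂ) 1, (g + u).1 z ≠ 0) :
    L (dirichletShift g) * L u = L (dirichletShift u) * L g := by
  have h1 := map_shift_shift_mul_eq_sq hL hg
  have h2 := map_shift_shift_mul_eq_sq hL hu
  have h3 := map_shift_shift_mul_eq_sq hL hgu
  simp only [map_add] at h3
  have hLg := hL g hg
  have hLu := hL u hu
  have h4 : (L (dirichletShift g) * L u - L (dirichletShift u) * L g) ^ 2 = 0 := by
    linear_combination (-L u * (L u + L g)) * h1 + (-L g * (L u + L g)) * h2 + (L u * L g) * h3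
  exact sub_eq_zero.mp (pow_eq_zero_iff two_ne_zero |>.mp h4)

/-- Every function in the Dirichlet space is a difference of functions in the Dirichlet space with
nonnegative real part. The minuend is the projection of `f` to the cone of functions with
nonnegative real part, which contains all reproducing kernels `1 - log (1 - conj w * z)`. -/
theorem MemDirichlet.exists_re_nonneg {f : ℂ → ℂ} (hf : MemDirichlet f) :
    ∃ h, MemDirichlet h ∧
      ∀ z ∈ ball (0 : ℂ) 1, 0 ≤ (h z).re ∧ 0 ≤ (h z - f z).re := by
  obtain ⟨a, ha, has⟩ := hf.exists_coeff
  let H := lp (fun _ : ℕ => ℂ) 2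
  let : InnerProductSpace ℝ H := InnerProductSpace.rclikeToReal ℂ H
  let ω : ℕ → ℝ := fun n => √(max (n : ℝ) 1)
  have hω2 : ∀ n : ℕ, ω n ^ 2 = max (n : ℝ) 1 := fun n =>
    Real.sq_sqrt (zero_le_one.trans (le_max_right _ _))
  have hω1 : ∀ n, 1 ≤ ω n := fun n => Real.one_le_sqrt.mpr (le_max_right _ _)
  have hω0 : ∀ n, ω n ≠ 0 := fun n => (zero_lt_one.trans_le (hω1 n)).ne'
  have hωc : ∀ n, (ω n : ℂ) ≠ 0 := fun n => ofReal_ne_zero.mpr (hω0 n)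
  have hmem : ∀ b : ℕ → ℂ, (Summable fun n => ‖b n‖ ^ 2) → ∃ x : H, ∀ n, x n = b n := by
    intro b hb
    have : Memℓp b 2 := by
      rw [memℓp_gen_iff (by norm_num)]
      simpa using hb
    exact ⟨⟨b, this⟩, fun n => rfl⟩
  have hsummable : ∀ x : H, Summable fun n => ‖x n‖ ^ 2 := by
    intro x
    simpa using (memℓp_gen_iff (p := 2) (by norm_num)).mp (lp.memℓp x)
  have hker : ∀ w : ball (0 : ℂ) 1, ∃ x : H, ∀ n, x n = conj (w : ℂ) ^ n / ω n := by
    intro w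
    refine hmem _ ?_
    have hw := mem_ball_zero_iff.mp w.2
    refine Summable.of_nonneg_of_le (fun n => by positivity) (fun n => ?_)
      (summable_geometric_of_lt_one (sq_nonneg ‖(w : ℂ)‖) (by nlinarith [norm_nonneg (w : ℂ)]))
    rw [norm_div, norm_pow, RCLike.norm_conj, norm_real, div_pow, ← pow_mul, ← pow_mul, mul_comm n]
    refine div_le_self (by positivity) ?_
    rw [Real.norm_eq_abs, sq_abs]
    exact one_le_pow₀ (hω1 n)
  choose k hk using hker
  have hinner : ∀ (w : ball (0 : ℂ) 1) (x : H),
      HasSum (fun n => x n / ω n * (w : ℂ) ^ n) (inner ℂ (k w) x) := by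
    intro w x
    convert! lp.hasSum_inner (𝕜 := ℂ) (k w) x using 2 with n
    rw [hk, RCLike.inner_apply, map_div₀, map_pow, conj_conj, conj_ofReal]
    ring
  obtain ⟨x, hx⟩ := hmem (fun n => ω n * a n) (by
    rw [← summable_nat_add_iff 1]
    refine ((summable_nat_add_iff 1).mpr has).congr fun n => ?_
    rw [norm_mul, mul_pow, norm_real, Real.norm_eq_abs, sq_abs, hω2, max_eq_left]
    exact_mod_cast Nat.le_add_left 1 n)
  let K : Set H := {y | ∀ w, 0 ≤ (inner ℂ (k w) y).re}
  have hK : ∀ w, k w ∈ K := by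
    intro u w
    set ζ : ℂ := conj (u : ℂ) * w with hζ
    have hζ1 : ‖ζ‖ < 1 := by
      rw [hζ, norm_mul, RCLike.norm_conj]
      have h1 := mem_ball_zero_iff.mp u.2
      have h2 := mem_ball_zero_iff.mp w.2
      nlinarith [norm_nonneg (u : ℂ), norm_nonneg (w : ℂ)]
    have h1 := (hasSum_taylorSeries_neg_log hζ1).add (hasSum_ite_eq 0 (1 : ℂ))
    have h2 : inner ℂ (k w) (k u) = -log (1 - ζ) + 1 := by
      refine (hinner w (k u)).unique ?_
      convert! h1 using 2 with n
      have h3 : (ω n : ℂ) ^ 2 = (max (n : ℝ) 1 : ℝ) := by exact_mod_cast hω2 n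
      rw [hk, div_div, ← pow_two, h3, hζ, mul_pow]
      rcases Nat.eq_zero_or_pos n with rfl | hn
      · simp
      · have h4 : (1 : ℝ) ≤ n := by exact_mod_cast hn
        rw [max_eq_left h4, if_neg hn.ne', ofReal_natCast]
        ring
    rw [h2, add_re, neg_re, one_re, log_re]
    have h3 : ‖1 - ζ‖ ≤ 2 := by
      have := norm_sub_le 1 ζ
      rw [norm_one] at this
      linarith
    have h4 : Real.log ‖1 - ζ‖ ≤ 1 := by
      have := Real.log_le_sub_one_of_pos (x := ‖1 - ζ‖) (norm_pos_iff.mpr (sub_ne_zero.mpr (by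
        intro h
        simp [← h] at hζ1)))
      linarith
    linarith
  have hKadd : ∀ y ∈ K, ∀ y' ∈ K, y + y' ∈ K := by
    intro y hy y' hy' w
    rw [inner_add_right, add_re]
    exact add_nonneg (hy w) (hy' w)
  have hKconv : Convex ℝ K := by
    have hsmul : ∀ s : ℝ, 0 ≤ s → ∀ y ∈ K, s • y ∈ K := by
      intro s hs y hy w
      have h : s • y = (s : ℂ) • y := rfl
      rw [h, inner_smul_right, re_ofReal_mul]
      exact mul_nonneg hs (hy w)
    intro y hy y' hy' s t hs ht _
    exact hKadd _ (hsmul s hs y hy) _ (hsmul t ht y' hy')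
  have hKclosed : IsClosed K := by
    have : K = ⋂ w, {y | 0 ≤ (inner ℂ (k w) y).re} := by
      ext y
      simp [K]
    rw [this]
    exact isClosed_iInter fun w => isClosed_le continuous_const (by fun_prop)
  obtain ⟨v, hvK, hv⟩ := exists_norm_eq_iInf_of_complete_convex
    ⟨0, fun w => by simp⟩ hKclosed.isComplete hKconv x
  have hvi := (norm_eq_iInf_iff_real_inner_le_zero hKconv hvK).mp hv
  have hsub : ∀ w, 0 ≤ (inner ℂ (k w) (v - x)).re := by
    intro w
    have := hvi (v + k w) (hKadd v hvK _ (hK w))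
    rw [add_sub_cancel_left, real_inner_comm, real_inner_eq_re_inner ℂ, ← neg_sub,
      inner_neg_right, map_neg] at this
    exact neg_nonpos.mp this
  have hvs : ∀ z (hz : z ∈ ball (0 : ℂ) 1),
      HasSum (fun n => v n / ω n * z ^ n) (∑' n, v n / ω n * z ^ n) :=
    fun z hz => (hinner ⟨z, hz⟩ v).summable.hasSum
  have hfx : ∀ z (hz : z ∈ ball (0 : ℂ) 1), inner ℂ (k ⟨z, hz⟩) x = f z := by
    intro z hz
    refine (hinner ⟨z, hz⟩ x).unique ?_
    convert! ha z hz using 3 with n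
    rw [hx]
    exact mul_div_cancel_left₀ _ (hωc n)
  refine ⟨fun z => ∑' n, v n / ω n * z ^ n, ?_, fun z hz => ?_⟩
  · rw [memDirichlet_iff_summable hvs]
    refine Summable.of_nonneg_of_le (fun n => by positivity) (fun n => ?_) (hsummable v)
    rw [norm_div, div_pow, norm_real, Real.norm_eq_abs, sq_abs, hω2, ← mul_div_assoc,
      div_le_iff₀ (by positivity), mul_comm]
    gcongr
    exact le_max_left _ _
  · have hvz : ∑' n, v n / ω n * z ^ n = inner ℂ (k ⟨z, hz⟩) v := (hinner ⟨z, hz⟩ v).tsum_eq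
    have h := hsub ⟨z, hz⟩
    rw [inner_sub_right, ← hvz, hfx z hz] at h
    exact ⟨(hvK ⟨z, hz⟩).trans_eq (congrArg re hvz.symm), h⟩

/-- Gleason–Kahane–Żelazko theorem for the Dirichlet space: a linear functional
`Λ` on `𝒟` (no continuity assumed) with `Λ(1) = 1` that is non-zero on all
nowhere-vanishing functions must be a point evaluation at some `a ∈ 𝔻`. -/
theorem dirichlet_GKZ (Λ : (ℂ → ℂ) → ℂ)
    (hadd : ∀ f g, MemDirichlet f → MemDirichlet g → Λ (f + g) = Λ f + Λ g)
    (hsmul : ∀ (c : ℂ) (f), MemDirichlet f → Λ (c • f) = c * Λ f)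
    (hcong : ∀ f g, MemDirichlet f → MemDirichlet g →
      Set.EqOn f g (Metric.ball 0 1) → Λ f = Λ g)
    (hone : Λ 1 = 1)
    (hnv : ∀ g, MemDirichlet g → (∀ z ∈ Metric.ball (0 : ℂ) 1, g z ≠ 0) → Λ g ≠ 0) :
    ∃ a ∈ Metric.ball (0 : ℂ) 1, ∀ f, MemDirichlet f → Λ f = f a := by
  let L : dirichletSpace →ₗ[ℂ] ℂ :=
    { toFun := fun g => Λ g.1
      map_add' := fun f g => hadd f.1 g.1 f.2 g.2
      map_smul' := fun c f => hsmul c f.1 f.2 }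
  have hL : ∀ g : dirichletSpace, (∀ z ∈ ball (0 : ℂ) 1, g.1 z ≠ 0) → L g ≠ 0 :=
    fun g hg => hnv g.1 g.2 hg
  let u : dirichletSpace := ⟨1, memDirichlet_const 1⟩
  have hu : L u = 1 := hone
  set a := L (dirichletShift u) with ha_def
  have ha : a ∈ ball (0 : ℂ) 1 := by
    by_contra hna
    refine hL (dirichletShift u - a • u) (fun z hz => ?_) (by simp [hu, ha_def])
    change z * 1 - a * 1 ≠ 0
    rw [mul_one, mul_one, sub_ne_zero]
    rintro rfl
    exact hna hz
  have hpos : ∀ g : dirichletSpace, (∀ z ∈ ball (0 : ℂ) 1, 0 < (g.1 z).re) →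
      L (dirichletShift g) = a * L g := by
    intro g hg
    have := map_shift_eq_of_ne_zero hL (g := g) (u := u)
      (fun z hz h0 => by have := hg z hz; rw [h0] at this; simp at this)
      (fun z _ => one_ne_zero)
      (fun z hz h0 => by
        have h1 := hg z hz
        have h2 : g.1 z + 1 = 0 := h0
        have h3 := congrArg re h2
        simp only [add_re, one_re, zero_re] at h3
        linarith)
    rwa [hu, mul_one] at this
  have hnonneg : ∀ g : dirichletSpace, (∀ z ∈ ball (0 : ℂ) 1, 0 ≤ (g.1 z).re) →
      L (dirichletShift g) = a * L g := by
    intro g hg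
    have := hpos (g + u) fun z hz => by
      have h1 := hg z hz
      change 0 < (g.1 z + 1).re
      rw [add_re, one_re]
      linarith
    rw [map_add, map_add, map_add, hu, ← ha_def] at this
    linear_combination this
  have hall : ∀ g : dirichletSpace, L (dirichletShift g) = a * L g := by
    intro g
    obtain ⟨h, hh, hre⟩ := MemDirichlet.exists_re_nonneg g.2
    let h' : dirichletSpace := ⟨h, hh⟩
    have h1 := hnonneg h' fun z hz => (hre z hz).1
    have h2 := hnonneg (h' - g) fun z hz => (hre z hz).2
    rw [map_sub, map_sub, map_sub] at h2
    linear_combination h1 - h2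
  refine ⟨a, ha, fun f hf => ?_⟩
  let q : dirichletSpace := ⟨dslope f a, hf.dslope ha⟩
  have hfq : (⟨f, hf⟩ : dirichletSpace) = f a • u + (dirichletShift q - a • q) := by
    ext z
    change f z = f a * 1 + (z * dslope f a z - a * dslope f a z)
    have := sub_smul_dslope f a z
    rw [smul_eq_mul] at this
    linear_combination -this
  have hLf : Λ f = L (⟨f, hf⟩ : dirichletSpace) := rfl
  rw [hLf, hfq, map_add, map_sub, map_smul, map_smul, hall, hu]
  simp
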